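/- Sears' transformation of a terminating balanced ₄φ₃: for n ∈ ℕ and nonzero complex numbers q, a, b, c, d, e, f with 0 < |q| < 1 satisfying the balancing condition d e f = q^{1−n} a b c, and such that no factor in the denominators below vanishes, one has ∑_{k=0}^n ((q^{−n};q)_k (a;q)_k (b;q)_k (c;q)_k) / ((d;q)_k (e;q)_k (f;q)_k (q;q)_k) · q^k = ((e/a;q)_n (f/a;q)_n / ((e;q)_n (f;q)_n)) · a^n · ∑_{k=0}^n ((q^{−n};q)_k (a;q)_k (d/b;q)_k (d/c;q)_k) / ((d;q)_k (q^{1−n}a/e;q)_k (q^{1−n}a/f;q)_k (q;q)_k) · q^k. -/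

import Mathlib

/-- The finite `q`-shifted factorial `(a;q)_k`. -/
noncomputable def qPoch (a q : ℂ) (k : ℕ) : ℂ := ∏ j ∈ Finset.range k, (1 - a * q ^ j)

theorem qPoch_zero (a q : ℂ) : qPoch a q 0 = 1 := by simp [qPoch]

theorem qPoch_succ (a q : ℂ) (k : ℕ) : qPoch a q (k + 1) = qPoch a q k * (1 - a * q ^ k) :=
  Finset.prod_range_succ _ _

theorem qPoch_add (a q : ℂ) (m i : ℕ) :
    qPoch a q (m + i) = qPoch a q m * qPoch (a * q ^ m) q i := by
  simp only [qPoch, Finset.prod_range_add, pow_add, mul_assoc]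

theorem qPoch_succ' (a q : ℂ) (k : ℕ) :
    qPoch a q (k + 1) = (1 - a) * qPoch (a * q) q k := by
  rw [add_comm, qPoch_add]
  simp [qPoch]

theorem qPoch_ne_zero_of_le {a q : ℂ} {k n : ℕ} (h : qPoch a q n ≠ 0) (hk : k ≤ n) :
    qPoch a q k ≠ 0 := by
  obtain ⟨i, rfl⟩ := Nat.exists_eq_add_of_le hk
  rw [qPoch_add] at h
  exact left_ne_zero_of_mul h

theorem qPoch_self_ne_zero {q : ℂ} (hq : ‖q‖ < 1) (k : ℕ) : qPoch q q k ≠ 0 := by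
  refine Finset.prod_ne_zero_iff.mpr fun j _ h => ?_
  have h1 : q ^ (j + 1) = 1 := by linear_combination -h
  have h2 : ‖q‖ ^ (j + 1) = 1 := by rw [← norm_pow, h1, norm_one]
  exact (pow_lt_one₀ (norm_nonneg q) hq j.succ_ne_zero).ne h2

/-- Reversal of the order of the factors of a `q`-shifted factorial. -/
theorem qPoch_mul_qPoch_reverse {q G H : ℂ} (hq : q ≠ 0) (m i : ℕ)
    (h : G * H * q ^ (m + i) = q) :
    qPoch G q m * qPoch H q i = qPoch H q (m + i) * ((-G) ^ m * q ^ m.choose 2) := by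
  induction m generalizing i with
  | zero => simp [qPoch_zero]
  | succ m ih =>
    have h1 : G * H * q ^ (m + i) = 1 := by
      apply mul_right_cancel₀ hq
      linear_combination h
    have h2 := ih (i + 1) (by rwa [← add_assoc, add_right_comm])
    rw [qPoch_succ] at h2
    have h3 : (m + 1).choose 2 = m + m.choose 2 := by simp [Nat.choose_succ_succ']
    rw [qPoch_succ, h3, show m + 1 + i = m + (i + 1) by ring]
    rw [pow_add] at h1 ⊢
    linear_combination (-G * q ^ m) * h2 - qPoch G q m * qPoch H q i * h1

theorem qPoch_ne_zero_of_reverse {q G H : ℂ} (hq : q ≠ 0) {n : ℕ} (h : G * H * q ^ n = q)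
    (hG : qPoch G q n ≠ 0) : qPoch H q n ≠ 0 := by
  have h' := qPoch_mul_qPoch_reverse hq n 0 h
  rw [qPoch_zero, mul_one, add_zero] at h'
  exact left_ne_zero_of_mul (h' ▸ hG)

/-- The summand of the division-free form of the `q`-Pfaff–Saalschütz sum. -/
noncomputable def saalschutzTerm (q x y t : ℂ) (j i : ℕ) : ℂ :=
  qPoch x q j * qPoch y q j * qPoch (x * y * t * q ^ j) q i * qPoch t q i * t ^ j /
    (qPoch q q j * qPoch q q i)

theorem one_sub_mul_pow_ne_zero {q : ℂ} (hq : ‖q‖ < 1) (k : ℕ) : 1 - q * q ^ k ≠ 0 := by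
  have h := qPoch_self_ne_zero hq (k + 1)
  rw [qPoch_succ] at h
  exact right_ne_zero_of_mul h

theorem sum_saalschutzTerm_telescope {q : ℂ} (hq : ‖q‖ < 1) (x y t : ℂ) (j i : ℕ) :
    ∑ l ∈ Finset.range (j + 1),
        ((1 - q * q ^ (j + i)) * saalschutzTerm q x y t l (j + i + 1 - l) -
          (1 - x * t * q ^ (j + i)) * (1 - y * t * q ^ (j + i)) *
            saalschutzTerm q x y t l (j + i - l)) =
      -(q ^ i * t * (1 - x * q ^ j) * (1 - y * q ^ j) * saalschutzTerm q x y t j i) := by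
  induction j generalizing i with
  | zero =>
    have h0 := qPoch_self_ne_zero hq i
    have h1 := one_sub_mul_pow_ne_zero hq i
    simp only [saalschutzTerm, zero_add, Finset.sum_range_one, Nat.sub_zero, qPoch_zero,
      qPoch_succ, pow_zero]
    field_simp
    ring
  | succ j ih =>
    have h0 := qPoch_self_ne_zero hq i
    have h1 := one_sub_mul_pow_ne_zero hq i
    have h2 := qPoch_self_ne_zero hq j
    have h3 := one_sub_mul_pow_ne_zero hq j
    have h4 := ih (i + 1)
    rw [show j + (i + 1) = j + 1 + i by ring] at h4
    rw [Finset.sum_range_succ, h4, show j + 1 + i + 1 - (j + 1) = i + 1 by omega,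
      show j + 1 + i - (j + 1) = i by omega]
    have h5 : qPoch (x * y * t * q ^ j) q (i + 1) =
        (1 - x * y * t * q ^ j) * qPoch (x * y * t * q ^ (j + 1)) q i := by
      rw [qPoch_succ', mul_assoc _ (q ^ j) q, ← pow_succ]
    simp only [saalschutzTerm, h5]
    simp only [qPoch_succ]
    generalize qPoch (x * y * t * q ^ (j + 1)) q i = D
    simp only [pow_succ, pow_add]
    generalize q ^ i = u at *
    generalize q ^ j = v at *
    generalize hα : 1 - q * u = α at *
    generalize hβ : 1 - q * v = β at *
    field_simp
    rw [← hα, ← hβ]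
    ring

/-- The `q`-Pfaff–Saalschütz sum, in division-free form. -/
theorem sum_saalschutzTerm {q : ℂ} (hq : ‖q‖ < 1) (x y t : ℂ) (k : ℕ) :
    ∑ j ∈ Finset.range (k + 1), saalschutzTerm q x y t j (k - j) =
      qPoch (x * t) q k * qPoch (y * t) q k / qPoch q q k := by
  induction k with
  | zero => simp [saalschutzTerm, qPoch_zero]
  | succ k ih =>
    have h0 := qPoch_self_ne_zero hq k
    have h1 := one_sub_mul_pow_ne_zero hq k
    have h := sum_saalschutzTerm_telescope hq x y t k 0
    simp only [add_zero, Finset.sum_sub_distrib, ← Finset.mul_sum, ih] at h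
    rw [Finset.sum_range_succ, Nat.sub_self]
    have h2 : (1 - q * q ^ k) * saalschutzTerm q x y t (k + 1) 0 =
        t * (1 - x * q ^ k) * (1 - y * q ^ k) * saalschutzTerm q x y t k 0 := by
      simp only [saalschutzTerm, qPoch_succ, qPoch_zero, pow_succ]
      field_simp
    apply mul_left_cancel₀ h1
    rw [mul_add, h2]
    have h3 : (1 - q * q ^ k) * (qPoch (x * t) q (k + 1) * qPoch (y * t) q (k + 1) /
        qPoch q q (k + 1)) = (1 - x * t * q ^ k) * (1 - y * t * q ^ k) *
          (qPoch (x * t) q k * qPoch (y * t) q k / qPoch q q k) := by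
      simp only [qPoch_succ]
      field_simp
    rw [h3]
    linear_combination h

/-- The `q`-Pfaff–Saalschütz sum of a terminating balanced `₃φ₂`. -/
theorem qPfaff_saalschutz {q : ℂ} (hq0 : q ≠ 0) (hq : ‖q‖ < 1) {P A B E F t : ℂ} (N : ℕ)
    (hABt : A * B * t = E) (hP : P * q ^ N = 1) (hF : F * t * q ^ N = q)
    (hE : qPoch E q N ≠ 0) (hFN : qPoch F q N ≠ 0) :
    ∑ m ∈ Finset.range (N + 1),
        qPoch P q m * qPoch A q m * qPoch B q m /
          (qPoch E q m * qPoch F q m * qPoch q q m) * q ^ m =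
      qPoch (A * t) q N * qPoch (B * t) q N / (qPoch E q N * qPoch t q N) := by
  subst hABt
  have hN := qPoch_self_ne_zero hq N
  have ht : qPoch t q N ≠ 0 := qPoch_ne_zero_of_reverse hq0 hF hFN
  have hP0 : P ≠ 0 := by rintro rfl; simp at hP
  have key : ∀ m ∈ Finset.range (N + 1),
      qPoch P q m * qPoch A q m * qPoch B q m /
          (qPoch (A * B * t) q m * qPoch F q m * qPoch q q m) * q ^ m =
        qPoch q q N / (qPoch (A * B * t) q N * qPoch t q N) *
          saalschutzTerm q A B t m (N - m) := by
    intro m hm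
    obtain ⟨i, rfl⟩ := Nat.exists_eq_add_of_le (Nat.lt_succ_iff.mp (Finset.mem_range.mp hm))
    have hEm := qPoch_ne_zero_of_le hE (Nat.le_add_right m i)
    have hFm := qPoch_ne_zero_of_le hFN (Nat.le_add_right m i)
    have hqm := qPoch_self_ne_zero hq m
    have hqi := qPoch_self_ne_zero hq i
    have h1 := qPoch_mul_qPoch_reverse hq0 m i hF
    have h2 := qPoch_mul_qPoch_reverse (G := P) (H := q) hq0 m i (by
      linear_combination q * hP)
    have h3 : F * t = P * q := mul_right_cancel₀ (pow_ne_zero (m + i) hq0) (by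
      linear_combination hF - q * hP)
    have h4 : F ^ m * t ^ m = P ^ m * q ^ m := by rw [← mul_pow, h3, mul_pow]
    rw [neg_pow] at h1 h2
    rw [Nat.add_sub_cancel_left, saalschutzTerm]
    rw [qPoch_add (A * B * t)] at hE ⊢
    have hEi := right_ne_zero_of_mul hE
    rw [div_mul_eq_mul_div, div_mul_div_comm, div_eq_div_iff (by simp [*]) (by simp [*])]
    linear_combination qPoch A q m * qPoch B q m * qPoch (A * B * t) q m *
      qPoch (A * B * t * q ^ m) q i * qPoch q q m *
        (q ^ m * qPoch t q (m + i) * h2 - qPoch q q (m + i) * t ^ m * h1 -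
          qPoch q q (m + i) * qPoch t q (m + i) * (-1) ^ m * q ^ m.choose 2 * h4)
  rw [Finset.sum_congr rfl key, ← Finset.mul_sum, sum_saalschutzTerm hq]
  field_simp

theorem mul_saalschutzTerm_eq {q d x y t : ℂ} (P a e f : ℂ) {j m : ℕ} (hxyt : x * y * t = d)
    (hd : qPoch d q (j + m) ≠ 0) :
    qPoch P q (j + m) * qPoch a q (j + m) /
        (qPoch d q (j + m) * qPoch e q (j + m) * qPoch f q (j + m)) * q ^ (j + m) *
          saalschutzTerm q x y t j m =
      qPoch P q j * qPoch a q j * qPoch x q j * qPoch y q j * t ^ j * q ^ j /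
        (qPoch d q j * qPoch e q j * qPoch f q j * qPoch q q j) *
        (qPoch (P * q ^ j) q m * qPoch (a * q ^ j) q m * qPoch t q m /
          (qPoch (e * q ^ j) q m * qPoch (f * q ^ j) q m * qPoch q q m) * q ^ m) := by
  rw [qPoch_add] at hd
  have hdm := mul_inv_cancel₀ (right_ne_zero_of_mul hd)
  rw [saalschutzTerm, hxyt]
  simp only [qPoch_add, pow_add]
  linear_combination
    (qPoch P q j * qPoch a q j * qPoch x q j * qPoch y q j * t ^ j * q ^ j /
        (qPoch d q j * qPoch e q j * qPoch f q j * qPoch q q j) *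
        (qPoch (P * q ^ j) q m * qPoch (a * q ^ j) q m * qPoch t q m /
          (qPoch (e * q ^ j) q m * qPoch (f * q ^ j) q m * qPoch q q m) * q ^ m)) * hdm

/-- The prefactor identity in Sears' transformation; here `u = q^{1−n}a/e`, `v = q^{1−n}a/f`
and `s = q^{1−n}/f` with `n = j + N`. -/
theorem sears_prefactor {q a e f t u v s : ℂ} (hq : q ≠ 0) (ha : a ≠ 0) (j N : ℕ)
    (hu : u * e * q ^ (j + N) = q * a) (hv : v * f * q ^ (j + N) = q * a)
    (hs : f * s * q ^ (j + N) = q) (htu : t * u = f) :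
    t ^ j * qPoch (e / a) q N * qPoch v q (j + N) * qPoch u q j * qPoch f q (j + N) =
      qPoch (e / a) q (j + N) * qPoch (f / a) q (j + N) * a ^ (j + N) * qPoch f q j *
        qPoch s q N := by
  have hf := qPoch_mul_qPoch_reverse hq j N hs
  have hfn := qPoch_mul_qPoch_reverse (G := f) (H := s) hq (j + N) 0 hs
  have he := qPoch_mul_qPoch_reverse (G := u) (H := e / a) hq j N
    (by field_simp; linear_combination hu)
  have hfa := qPoch_mul_qPoch_reverse (G := f / a) (H := v) hq (j + N) 0
    (by field_simp; linear_combination hv)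
  rw [qPoch_zero, mul_one, add_zero, neg_pow] at hfn hfa
  rw [neg_pow] at hf he
  have h1 : t ^ j * u ^ j = f ^ j := by rw [← mul_pow, htu]
  have h2 : (f / a) ^ (j + N) * a ^ (j + N) = f ^ (j + N) := by
    rw [← mul_pow, div_mul_cancel₀ _ ha]
  calc
    _ = t ^ j * qPoch v q (j + N) * (qPoch u q j * qPoch (e / a) q N) *
        qPoch f q (j + N) := by ring
    _ = qPoch (e / a) q (j + N) * qPoch v q (j + N) * qPoch s q (j + N) *
        ((-1) ^ j * (t ^ j * u ^ j) * q ^ j.choose 2) *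
        ((-1) ^ (j + N) * f ^ (j + N) * q ^ (j + N).choose 2) := by rw [he, hfn]; ring
    _ = qPoch (e / a) q (j + N) * (qPoch v q (j + N) *
          ((-1) ^ (j + N) * (f / a) ^ (j + N) * q ^ (j + N).choose 2)) * a ^ (j + N) *
          (qPoch s q (j + N) * ((-1) ^ j * f ^ j * q ^ j.choose 2)) := by rw [h1, ← h2]; ring
    _ = _ := by rw [← hf, ← hfa]; ring

/-- Sears' transformation of a terminating balanced `₄φ₃`:
`₄φ₃(q^{−n}, a, b, c; d, e, f; q, q)
  = ((e/a;q)_n (f/a;q)_n / ((e;q)_n (f;q)_n)) · a^n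
    · ₄φ₃(q^{−n}, a, d/b, d/c; d, q^{1−n}a/e, q^{1−n}a/f; q, q)`,
under the balancing condition `def = q^{1−n}abc`; `0 < ‖q‖ < 1`, all parameters
nonzero, and no factor in the denominators vanishes. -/
theorem sears_transformation (n : ℕ) (q a b c d e f : ℂ) (hq0 : 0 < ‖q‖) (hq1 : ‖q‖ < 1)
    (ha : a ≠ 0) (hb : b ≠ 0) (hc : c ≠ 0) (hd : d ≠ 0) (he : e ≠ 0) (hf : f ≠ 0)
    (hbal : d * e * f = q ^ ((1 : ℤ) - n) * a * b * c)
    (h1 : qPoch d q n ≠ 0) (h2 : qPoch e q n ≠ 0) (h3 : qPoch f q n ≠ 0)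
    (h4 : qPoch (q ^ ((1 : ℤ) - n) * a / e) q n ≠ 0)
    (h5 : qPoch (q ^ ((1 : ℤ) - n) * a / f) q n ≠ 0) :
    ∑ k ∈ Finset.range (n + 1),
        qPoch (q ^ (-(n : ℤ))) q k * qPoch a q k * qPoch b q k * qPoch c q k /
          (qPoch d q k * qPoch e q k * qPoch f q k * qPoch q q k) * q ^ k
      = qPoch (e / a) q n * qPoch (f / a) q n / (qPoch e q n * qPoch f q n) * a ^ n *
        ∑ k ∈ Finset.range (n + 1),
          qPoch (q ^ (-(n : ℤ))) q k * qPoch a q k * qPoch (d / b) q k *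
            qPoch (d / c) q k /
            (qPoch d q k * qPoch (q ^ ((1 : ℤ) - n) * a / e) q k *
              qPoch (q ^ ((1 : ℤ) - n) * a / f) q k * qPoch q q k) * q ^ k := by
  have hq : q ≠ 0 := norm_pos_iff.mp hq0
  have hqn : q ^ n ≠ 0 := pow_ne_zero n hq
  have hz : q ^ ((1 : ℤ) - n) = q / q ^ n := by rw [zpow_sub₀ hq, zpow_one, zpow_natCast]
  have hP : q ^ (-(n : ℤ)) * q ^ n = 1 := by rw [zpow_neg, zpow_natCast, inv_mul_cancel₀ hqn]
  rw [hz] at hbal h4 h5 ⊢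
  generalize q ^ (-(n : ℤ)) = P at *
  set t := b * c / d with ht
  have hbt : d / c * t = b := by rw [ht]; field_simp
  have hct : d / b * t = c := by rw [ht]; field_simp
  have hdt : d / b * (d / c) * t = d := by rw [ht]; field_simp
  have hef : e * f * q ^ n = q * a * t := by
    rw [ht]
    field_simp at hbal ⊢
    linear_combination hbal
  have hleft : ∀ k ∈ Finset.range (n + 1),
      qPoch P q k * qPoch a q k * qPoch b q k * qPoch c q k /
          (qPoch d q k * qPoch e q k * qPoch f q k * qPoch q q k) * q ^ k =
        ∑ j ∈ Finset.range (k + 1), qPoch P q k * qPoch a q k /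
          (qPoch d q k * qPoch e q k * qPoch f q k) * q ^ k *
            saalschutzTerm q (d / b) (d / c) t j (k - j) := by
    intro k _
    rw [← Finset.mul_sum, sum_saalschutzTerm hq1, hbt, hct]
    ring
  have hright : ∀ j ∈ Finset.range (n + 1),
      ∑ m ∈ Finset.range (n + 1 - j), qPoch P q (j + m) * qPoch a q (j + m) /
          (qPoch d q (j + m) * qPoch e q (j + m) * qPoch f q (j + m)) * q ^ (j + m) *
            saalschutzTerm q (d / b) (d / c) t j m =
        qPoch (e / a) q n * qPoch (f / a) q n / (qPoch e q n * qPoch f q n) * a ^ n *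
          (qPoch P q j * qPoch a q j * qPoch (d / b) q j * qPoch (d / c) q j /
            (qPoch d q j * qPoch (q / q ^ n * a / e) q j *
              qPoch (q / q ^ n * a / f) q j * qPoch q q j) * q ^ j) := by
    intro j hj
    obtain ⟨N, rfl⟩ := Nat.exists_eq_add_of_le (Nat.lt_succ_iff.mp (Finset.mem_range.mp hj))
    set τ := q / q ^ (j + N) / f with hτ
    have hfτ : f * τ * q ^ (j + N) = q := by rw [hτ]; field_simp
    have haτ : a * q ^ j * τ = q / q ^ (j + N) * a / f * q ^ j := by rw [hτ]; ring
    have htτ : t * τ = e / a := by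
      rw [hτ]
      field_simp
      linear_combination -hef
    have heτ : a * q ^ j * t * τ = e * q ^ j := by
      rw [mul_assoc, htτ]
      field_simp
    have hterm : ∀ m ∈ Finset.range (N + 1), _ := fun m hm =>
      mul_saalschutzTerm_eq P a e f hdt (qPoch_ne_zero_of_le h1
        (Nat.add_le_add_left (Nat.lt_succ_iff.mp (Finset.mem_range.mp hm)) j))
    have h2' := h2
    have h3' := h3
    have h5' := h5
    rw [qPoch_add] at h2' h3' h5'
    rw [show j + N + 1 - j = N + 1 by omega, Finset.sum_congr rfl hterm, ← Finset.mul_sum,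
      qPfaff_saalschutz hq hq1 N heτ (by linear_combination hP) (by linear_combination hfτ)
        (right_ne_zero_of_mul h2') (right_ne_zero_of_mul h3'), haτ, htτ]
    have hpre := sears_prefactor (e := e) (t := t) (u := q / q ^ (j + N) * a / e)
      (v := q / q ^ (j + N) * a / f) hq ha j N (by field_simp) (by field_simp) hfτ (by
        field_simp
        linear_combination -hef)
    have hτN : qPoch τ q N ≠ 0 :=
      qPoch_ne_zero_of_le (qPoch_ne_zero_of_reverse hq hfτ h3) (Nat.le_add_left N j)
    have hu := qPoch_ne_zero_of_le h4 (Nat.le_add_right j N)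
    generalize q / q ^ (j + N) * a / e = u at *
    generalize q / q ^ (j + N) * a / f = v at *
    rw [qPoch_add v] at hpre
    have hquot : t ^ j * (qPoch (v * q ^ j) q N * qPoch (e / a) q N) /
        (qPoch e q j * qPoch f q j * (qPoch (e * q ^ j) q N * qPoch τ q N)) =
        qPoch (e / a) q (j + N) * qPoch (f / a) q (j + N) * a ^ (j + N) /
          (qPoch e q (j + N) * qPoch f q (j + N) * (qPoch u q j * qPoch v q j)) := by
      rw [qPoch_add e, div_eq_div_iff (by simp_all) (by simp_all)]
      linear_combination qPoch e q j * qPoch (e * q ^ j) q N * hpre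
    linear_combination qPoch P q j * qPoch a q j * qPoch (d / b) q j * qPoch (d / c) q j *
      q ^ j / (qPoch d q j * qPoch q q j) * hquot
  rw [Finset.sum_congr rfl hleft, Finset.mul_sum, ← Finset.sum_congr rfl hright,
    ← Finset.sum_range_diag_flip]
  refine Finset.sum_congr rfl fun k _ => Finset.sum_congr rfl fun j hj => ?_
  rw [Nat.add_sub_cancel' (Nat.lt_succ_iff.mp (Finset.mem_range.mp hj))]
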